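/- arXiv:1708.03037 — 4 statements merged into one kernel-verified Lean document; each statement's English description precedes it below -/
import Mathlib

section
/- Let H be the set of positive integers n such that for every prime p > 1000 the p-adic valuation v_p(n) is at most 1, and for every prime p < 1000 the p-adic valuation v_p(n) is at most ⌊9·log 10 / log p⌋ − 1. If a multiplicative function f : ℕ → ℂ satisfies f(p+q-2) = f(p) + f(q) - f(2) for all primes p and q, and f(2) = 2, then f(n) = n for all n ∈ H. -/
/-- The Spiro set `H`: positive integers whose `p`-adic valuation is at most `1`
for primes `p > 1000` and at most `⌊9 log 10 / log p⌋ - 1` for primes `p < 1000`. -/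
def SpiroH : Set ℕ :=
  {n | 0 < n ∧ ∀ p : ℕ, p.Prime →
    (1000 < p → padicValNat p n ≤ 1) ∧
    (p < 1000 → (padicValNat p n : ℤ) ≤ ⌊(9 : ℝ) * Real.log 10 / Real.log p⌋ - 1)}

open Finset in
/-- Chebyshev-type bound for the primes in an arithmetic progression of prime power modulus. -/
lemma prod_primes_progression_le {r d a N : ℕ} (hr : r.Prime) (hd : ∃ k, d = r ^ k)
    (ha : 0 < a) (had : a ≤ d) (A : Finset ℕ)
    (hA : ∀ q ∈ A, q.Prime ∧ N < q ∧ ∃ k < N, q = a + d * k) :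
    ∏ q ∈ A, q ≤ (r * d) ^ N := by
  have hd0 : 0 < d := ha.trans_le had
  set v := N.factorial.factorization r with hv
  set n' := N.factorial / r ^ v with hn'
  have hfac : r ^ v * n' = N.factorial := Nat.ordProj_mul_ordCompl_eq_self _ _
  have hn'pos : 0 < n' := by
    rcases Nat.eq_zero_or_pos n' with h | h
    · rw [h, mul_zero] at hfac; exact absurd hfac.symm N.factorial_ne_zero
    · exact h
  have hcop : Nat.Coprime d n' := by
    obtain ⟨k, rfl⟩ := hd
    exact (Nat.coprime_ordCompl hr N.factorial_ne_zero).pow_left k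
  have hvN : v ≤ N := by
    have := Fact.mk hr
    have h := sub_one_mul_padicValNat_factorial (p := r) N
    rw [← Nat.factorization_def _ hr, ← hv] at h
    have h2 := hr.two_le
    calc v = 1 * v := (one_mul v).symm
      _ ≤ (r - 1) * v := Nat.mul_le_mul_right _ (by omega)
      _ ≤ N := by omega
  set P := ∏ k ∈ range N, (a + d * k) with hP
  have h1 : n' ∣ P := by
    have : NeZero n' := ⟨hn'pos.ne'⟩
    rw [← CharP.cast_eq_zero_iff (ZMod n') n']
    set b := ((a : ZMod n') * (d : ZMod n')⁻¹).val with hb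
    have hbd : (a : ZMod n') = d * b := by
      rw [hb, ZMod.natCast_zmod_val, mul_left_comm, ZMod.coe_mul_inv_eq_one d hcop, mul_one]
    have hz : ((b.ascFactorial N : ℕ) : ZMod n') = 0 := by
      rw [CharP.cast_eq_zero_iff (ZMod n') n']
      exact (Dvd.intro_left _ hfac).trans (Nat.factorial_dvd_ascFactorial b N)
    rw [Nat.ascFactorial_eq_prod_range] at hz
    push_cast at hz
    rw [hP]
    push_cast
    have : ∀ k ∈ range N, (a : ZMod n') + d * k = d * (b + k) := by
      intro k _; rw [hbd]; ring
    rw [prod_congr rfl this, prod_mul_distrib, hz, mul_zero]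
  have h2 : ∏ q ∈ A, q ∣ P := by
    have hsub : A ⊆ (range N).image (fun k => a + d * k) := by
      intro q hq
      obtain ⟨-, -, k, hk, rfl⟩ := hA q hq
      exact mem_image_of_mem _ (mem_range.2 hk)
    have himg : ∏ q ∈ (range N).image (fun k => a + d * k), q = P := by
      rw [prod_image]
      intro x _ y _ hxy
      exact Nat.eq_of_mul_eq_mul_left hd0 (Nat.add_left_cancel hxy)
    rw [← himg]
    exact prod_dvd_prod_of_subset _ _ _ hsub
  have h3 : Nat.Coprime n' (∏ q ∈ A, q) := by
    refine Nat.Coprime.prod_right fun q hq => ?_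
    obtain ⟨hqp, hqN, -⟩ := hA q hq
    refine Nat.Coprime.coprime_dvd_left (Dvd.intro_left _ hfac) ?_
    rw [Nat.coprime_comm, hqp.coprime_iff_not_dvd, hqp.dvd_factorial]
    omega
  have hPle : P ≤ d ^ N * N.factorial := by
    rw [← prod_range_add_one_eq_factorial, hP]
    calc ∏ k ∈ range N, (a + d * k) ≤ ∏ k ∈ range N, (d * (k + 1)) :=
          prod_le_prod' fun k _ => by rw [mul_add, mul_one]; omega
      _ = _ := by rw [prod_mul_distrib, prod_const, card_range]
  have hPpos : 0 < P := prod_pos fun k _ => by omega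
  have h4 := (Nat.le_of_dvd hPpos (h3.mul_dvd_of_dvd_of_dvd h1 h2)).trans hPle
  rw [← hfac] at h4
  have h5 : n' * ∏ q ∈ A, q ≤ n' * (d ^ N * r ^ v) := by
    calc _ ≤ _ := h4
      _ = _ := by ring
  calc ∏ q ∈ A, q ≤ d ^ N * r ^ v := Nat.le_of_mul_le_mul_left h5 hn'pos
    _ ≤ d ^ N * r ^ N := Nat.mul_le_mul_left _ (Nat.pow_le_pow_right hr.pos hvN)
    _ = _ := by rw [mul_pow, mul_comm]

/-- The least power of `r` that is at least `10 ^ 6`, or `r ^ 2` if that is larger. -/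
def badModulus (r : ℕ) : ℕ := if r < 1000 then r ^ Nat.clog r (10 ^ 6) else r ^ 2

lemma badModulus_dvd {r k : ℕ} (hr : r.Prime) (hk : 2 ≤ k) (h : 10 ^ 6 ≤ r ^ k) :
    badModulus r ∣ r ^ k := by
  unfold badModulus
  split_ifs
  · exact pow_dvd_pow _ ((Nat.clog_le_iff_le_pow hr.one_lt).2 h)
  · exact pow_dvd_pow _ hk

lemma le_badModulus {r : ℕ} (hr : r.Prime) : 10 ^ 6 ≤ badModulus r := by
  unfold badModulus
  split_ifs with h
  · exact Nat.le_pow_clog hr.one_lt _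
  · nlinarith

lemma badModulus_lt {r : ℕ} (hr : r.Prime) (h : r < 1000) : badModulus r < 10 ^ 6 * r := by
  have h1 := Nat.pow_pred_clog_lt_self hr.one_lt (x := 10 ^ 6) (by norm_num)
  have h2 : 0 < Nat.clog r (10 ^ 6) := Nat.clog_pos hr.one_lt (by norm_num)
  unfold badModulus
  rw [if_pos h, ← Nat.succ_pred_eq_of_pos h2, pow_succ]
  exact Nat.mul_lt_mul_of_pos_right h1 hr.pos

lemma badModulus_eq_pow (r : ℕ) : ∃ k, badModulus r = r ^ k := by
  unfold badModulus
  split_ifs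
  exacts [⟨_, rfl⟩, ⟨_, rfl⟩]

lemma sum_log_progression_le {r p N₀ : ℕ} (hr : r.Prime) (hp : 2 ≤ p)
    (hN₀ : p / badModulus r + 1 ≤ N₀) (A : Finset ℕ)
    (hA : ∀ q ∈ A, q.Prime ∧ N₀ < q ∧ q < p ∧ badModulus r ∣ p + q - 2) :
    ∑ q ∈ A, Real.log q ≤ ((p : ℝ) / badModulus r + 1) * Real.log (r * badModulus r) := by
  set d := badModulus r with hd
  have hd0 : 0 < d := lt_of_lt_of_le (by norm_num) (le_badModulus hr)
  have hpow : ∃ k, d = r ^ k := badModulus_eq_pow r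
  clear_value d
  have hrd : (1 : ℝ) ≤ r * d := by exact_mod_cast Nat.mul_pos hr.pos hd0
  rcases A.eq_empty_or_nonempty with rfl | ⟨q₀, hq₀⟩
  · rw [Finset.sum_empty]
    have := Real.log_nonneg hrd
    positivity
  set a := (q₀ - 1) % d + 1 with ha
  have key : ∏ q ∈ A, q ≤ (r * d) ^ (p / d + 1) := by
    refine prod_primes_progression_le (a := a) hr hpow (Nat.succ_pos _)
      (Nat.mod_lt _ hd0) A fun q hq => ?_
    obtain ⟨hqp, hqN, hqlt, hdvd⟩ := hA q hq
    obtain ⟨hqp', -, -, hdvd'⟩ := hA q₀ hq₀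
    refine ⟨hqp, by omega, (q - 1) / d,
      Nat.lt_succ_of_le (Nat.div_le_div_right (by omega)), ?_⟩
    have hmod : q - 1 ≡ q₀ - 1 [MOD d] := by
      apply Nat.ModEq.add_left_cancel' (p - 1)
      have e1 : p - 1 + (q - 1) = p + q - 2 := by have := hqp.two_le; omega
      have e2 : p - 1 + (q₀ - 1) = p + q₀ - 2 := by have := hqp'.two_le; omega
      rw [e1, e2]
      exact ((Nat.modEq_zero_iff_dvd).2 hdvd).trans ((Nat.modEq_zero_iff_dvd).2 hdvd').symm
    have h1 := Nat.mod_add_div (q - 1) d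
    rw [hmod] at h1
    have := hqp.two_le
    omega
  have hApos : ∀ q ∈ A, (q : ℝ) ≠ 0 := fun q hq => by exact_mod_cast (hA q hq).1.ne_zero
  rw [← Real.log_prod hApos]
  have hpos : (0 : ℝ) < ∏ q ∈ A, (q : ℝ) :=
    Finset.prod_pos fun q hq => by exact_mod_cast (hA q hq).1.pos
  have key' : ((∏ q ∈ A, q : ℕ) : ℝ) ≤ ((r * d) ^ (p / d + 1) : ℕ) := by exact_mod_cast key
  push_cast at key'
  calc Real.log (∏ q ∈ A, (q : ℝ)) ≤ Real.log (((r : ℝ) * d) ^ (p / d + 1)) :=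
        Real.log_le_log hpos key'
    _ = ((p / d : ℕ) + 1 : ℝ) * Real.log (r * d) := by rw [Real.log_pow]; push_cast; ring
    _ ≤ _ := by
      gcongr
      · exact Real.log_nonneg hrd
      · exact Nat.cast_div_le

lemma log_le_div_1024_add {x : ℝ} (hx : 0 < x) : Real.log x ≤ x / 1024 + 5.94 := by
  have h := Real.log_le_sub_one_of_pos (x := x / 1024) (by positivity)
  rw [Real.log_div hx.ne' (by norm_num), show (1024 : ℝ) = 2 ^ 10 by norm_num, Real.log_pow] at h
  have := Real.log_two_lt_d9
  push_cast at h
  norm_num at h ⊢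
  linarith

lemma log_le_sqrt {x : ℝ} (hx : 0 < x) : Real.log x ≤ √x := by
  have hs := Real.sqrt_pos.2 hx
  have h := Real.log_le_sub_one_of_pos (x := √x / 2) (by positivity)
  rw [Real.log_div hs.ne' (by norm_num), Real.log_sqrt hx.le] at h
  have := Real.log_two_lt_d9
  linarith

lemma sum_one_div_mul_sqrt_le (n : ℕ) :
    ∑ r ∈ Finset.Ico 1000 n, 1 / ((r : ℝ) * √r) ≤ 0.0634 := by
  have step : ∀ r : ℕ, 1000 ≤ r →
      1 / ((r : ℝ) * √r) ≤ 2 / √((r : ℝ) - 1) - 2 / √r := by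
    intro r hr
    have hr' : (1000 : ℝ) ≤ r := by exact_mod_cast hr
    set a := √((r : ℝ) - 1) with ha
    set b := √(r : ℝ) with hb
    have ha0 : 0 < a := Real.sqrt_pos.2 (by linarith)
    have hb0 : 0 < b := Real.sqrt_pos.2 (by linarith)
    have ha2 : a ^ 2 = r - 1 := Real.sq_sqrt (by linarith)
    have hb2 : b ^ 2 = r := Real.sq_sqrt (by linarith)
    have hab : a ≤ b := Real.sqrt_le_sqrt (by linarith)
    have e : 2 / a - 2 / b = 2 / (a * b * (a + b)) := by
      rw [div_sub_div _ _ ha0.ne' hb0.ne', div_eq_div_iff (by positivity) (by positivity)]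
      linear_combination (2 * a * b) * (hb2 - ha2)
    rw [e, ← hb2, div_le_div_iff₀ (by positivity) (by positivity)]
    have : a * b * (a + b) ≤ b * b * (b + b) := by gcongr
    nlinarith
  have tel : ∀ n : ℕ, 1000 ≤ n → ∑ r ∈ Finset.Ico 1000 n, 1 / ((r : ℝ) * √r) ≤
      2 / √999 - 2 / √((n : ℝ) - 1) := by
    intro n hn
    induction n, hn using Nat.le_induction with
    | base => norm_num
    | succ n hn ih =>
      rw [Finset.sum_Ico_succ_top hn]
      have := step n hn
      push_cast
      rw [add_sub_cancel_right]
      linarith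
  rcases le_or_gt 1000 n with h | h
  · have h1 := tel n h
    have h2 : (0 : ℝ) ≤ 2 / √((n : ℝ) - 1) := by positivity
    have h3 : (31.6 : ℝ) ≤ √999 := Real.le_sqrt_of_sq_le (by norm_num)
    have h4 : 2 / √999 ≤ 2 / (31.6 : ℝ) := by gcongr
    have h5 : 2 / (31.6 : ℝ) ≤ 0.0634 := by norm_num
    linarith
  · rw [Finset.Ico_eq_empty (by omega)]; norm_num

lemma badModulus_term_le_small {r p : ℕ} (hr : r.Prime) (h : r < 1000) (hp : 10 ^ 6 ≤ p) :
    ((p : ℝ) / badModulus r + 1) * Real.log (r * badModulus r) ≤ 0.000056 * p := by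
  have h1 : ((10 : ℝ) ^ 6) ≤ badModulus r := by exact_mod_cast le_badModulus hr
  have h2 : (badModulus r : ℝ) < 10 ^ 6 * r := by exact_mod_cast badModulus_lt hr h
  have hr1 : (1 : ℝ) ≤ r := by exact_mod_cast hr.pos
  have hr2 : (r : ℝ) ≤ 1000 := by exact_mod_cast h.le
  have hp' : (10 : ℝ) ^ 6 ≤ p := by exact_mod_cast hp
  have hl : Real.log (r * badModulus r) ≤ 28 := by
    calc Real.log (r * badModulus r) ≤ Real.log (2 ^ 40) := by
          apply Real.log_le_log (by positivity)
          nlinarith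
      _ ≤ 28 := by
          rw [Real.log_pow]; have := Real.log_two_lt_d9; push_cast; linarith
  have hq : (p : ℝ) / badModulus r ≤ p / 10 ^ 6 := by gcongr
  calc _ ≤ ((p : ℝ) / badModulus r + 1) * 28 := by gcongr
    _ ≤ (p / 10 ^ 6 + 1) * 28 := by gcongr
    _ ≤ _ := by linarith

lemma badModulus_term_le_large {r p : ℕ} (h : 1000 ≤ r) (hrp : r ^ 2 ≤ 2 * p) :
    ((p : ℝ) / badModulus r + 1) * Real.log (r * badModulus r) ≤
      3 * p * (1 / ((r : ℝ) * √r)) + 3 * Real.log √(2 * p) := by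
  have hr0 : (0 : ℝ) < r := by exact_mod_cast (by omega : 0 < r)
  have hb : badModulus r = r ^ 2 := by unfold badModulus; rw [if_neg (by omega)]
  rw [hb]
  push_cast
  have e : Real.log ((r : ℝ) * r ^ 2) = 3 * Real.log r := by
    rw [← pow_succ', Real.log_pow]; norm_num
  have h1 : Real.log r ≤ Real.log √(2 * p) :=
    Real.log_le_log hr0 (Real.le_sqrt_of_sq_le (by exact_mod_cast hrp))
  have h2 := log_le_sqrt hr0
  have hs : √(r : ℝ) ^ 2 = r := Real.sq_sqrt hr0.le
  have hs0 := Real.sqrt_pos.2 hr0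
  have h3 : (p : ℝ) / r ^ 2 * (3 * Real.log r) ≤ 3 * p * (1 / ((r : ℝ) * √r)) := by
    calc (p : ℝ) / r ^ 2 * (3 * Real.log r) ≤ p / r ^ 2 * (3 * √r) := by gcongr
      _ = 3 * p * (1 / ((r : ℝ) * √r)) := by
        field_simp
        rw [hs]
  rw [e, add_mul, one_mul]
  linarith

lemma sum_badModulus_term_le {p : ℕ} (hp : 10 ^ 6 ≤ p) :
    ∑ r ∈ (Finset.range (Nat.sqrt (2 * p) + 1)).filter Nat.Prime,
      ((p : ℝ) / badModulus r + 1) * Real.log (r * badModulus r) ≤ 0.3 * p := by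
  set T := Nat.sqrt (2 * p) with hT
  have hp' : (10 : ℝ) ^ 6 ≤ p := by exact_mod_cast hp
  have hT1 : 1000 ≤ T := Nat.le_sqrt.2 (by omega)
  set s := √(2 * (p : ℝ)) with hs
  have hs1 : (1414 : ℝ) ≤ s := Real.le_sqrt_of_sq_le (by linarith)
  have hs2 : s ^ 2 = 2 * p := Real.sq_sqrt (by positivity)
  have hTs : (T : ℝ) ≤ s := Real.le_sqrt_of_sq_le (by exact_mod_cast Nat.sqrt_le' (2 * p))
  have hls : Real.log s ≤ s / 1024 + 5.94 := log_le_div_1024_add (by linarith)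
  have hls0 : 0 ≤ Real.log s := Real.log_nonneg (by linarith)
  have hle : ∀ r ∈ (Finset.range (T + 1)).filter Nat.Prime,
      ((p : ℝ) / badModulus r + 1) * Real.log (r * badModulus r) ≤
      if r < 1000 then 0.000056 * (p : ℝ) else 3 * p * (1 / ((r : ℝ) * √r)) + 3 * Real.log s := by
    intro r hr
    rw [Finset.mem_filter, Finset.mem_range] at hr
    split_ifs with h
    · exact badModulus_term_le_small hr.2 h hp
    · exact badModulus_term_le_large (by omega)
        ((Nat.pow_le_pow_left (by omega : r ≤ T) 2).trans (Nat.sqrt_le' _))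
  refine (Finset.sum_le_sum hle).trans ?_
  refine (Finset.sum_le_sum_of_subset_of_nonneg (Finset.filter_subset _ _) ?_).trans ?_
  · intro r _ _
    split_ifs <;> positivity
  rw [Finset.range_eq_Ico, ← Finset.sum_Ico_consecutive _ (Nat.zero_le 1000) (by omega)]
  have e1 : ∑ r ∈ Finset.Ico (0 : ℕ) 1000, (if r < 1000 then 0.000056 * (p : ℝ) else
      3 * p * (1 / ((r : ℝ) * √r)) + 3 * Real.log s) = 0.056 * p := by
    rw [Finset.sum_congr rfl fun r hr => if_pos (Finset.mem_Ico.1 hr).2]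
    rw [Finset.sum_const, Nat.card_Ico, nsmul_eq_mul]
    push_cast; ring
  have e2 : ∑ r ∈ Finset.Ico (1000 : ℕ) (T + 1), (if r < 1000 then 0.000056 * (p : ℝ) else
      3 * p * (1 / ((r : ℝ) * √r)) + 3 * Real.log s) ≤ 3 * p * 0.0634 + s * (3 * Real.log s) := by
    rw [Finset.sum_congr rfl fun r hr => if_neg (not_lt.2 (Finset.mem_Ico.1 hr).1)]
    rw [Finset.sum_add_distrib, ← Finset.mul_sum, Finset.sum_const, Nat.card_Ico, nsmul_eq_mul]
    have hc : ((T + 1 - 1000 : ℕ) : ℝ) ≤ s := le_trans (by exact_mod_cast (by omega)) hTs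
    have := sum_one_div_mul_sqrt_le (T + 1)
    gcongr
  have e3 : s * (3 * Real.log s) ≤ 3 * s * (s / 1024 + 5.94) := by
    calc _ = 3 * s * Real.log s := by ring
      _ ≤ _ := by gcongr
  rw [e1]
  nlinarith

lemma theta_sub_one_ge {p : ℕ} (hp : 10 ^ 6 ≤ p) :
    0.6 * (p : ℝ) ≤ Chebyshev.theta ((p - 1 : ℕ) : ℝ) := by
  have h := Chebyshev.theta_ge (p - 1)
  have hp' : (10 : ℝ) ^ 6 ≤ p := by exact_mod_cast hp
  rw [Nat.cast_sub (by omega)] at h ⊢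
  push_cast at h ⊢
  rw [sub_add_cancel] at h
  set t := √(p : ℝ) with ht
  have ht1 : (1000 : ℝ) ≤ t := Real.le_sqrt_of_sq_le (by linarith)
  have ht2 : t ^ 2 = p := Real.sq_sqrt (by positivity)
  have hlt : Real.log t ≤ t / 1024 + 5.94 := log_le_div_1024_add (by linarith)
  have hlp : Real.log p = 2 * Real.log t := by rw [ht, Real.log_sqrt (by positivity)]; ring
  have hlt0 : 0 ≤ Real.log t := Real.log_nonneg (by linarith)
  have h1 : √((p : ℝ) - 1) ≤ t := Real.sqrt_le_sqrt (by linarith)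
  have h2 : Real.log ((p : ℝ) - 1) ≤ 2 * Real.log t := by
    rw [← hlp]; exact Real.log_le_log (by linarith) (by linarith)
  have h3 : 2 * √((p : ℝ) - 1) * Real.log (p - 1) ≤ 2 * t * (2 * (t / 1024 + 5.94)) := by
    calc _ ≤ 2 * t * (2 * Real.log t) := by
          gcongr
          exact Real.log_nonneg (by linarith)
      _ ≤ _ := by gcongr
  have h4 : ((p : ℝ) - 1) * 0.693 ≤ (p - 1) * Real.log 2 := by
    have := Real.log_two_gt_d9
    gcongr
    · linarith
    · linarith
  nlinarith

lemma exists_prime_add_not_bad {p : ℕ} (hp : 10 ^ 6 ≤ p) :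
    ∃ q, q.Prime ∧ 2 < q ∧ q < p ∧
      ∀ r k : ℕ, r.Prime → 2 ≤ k → r ^ k ∣ p + q - 2 → r ^ k < 10 ^ 6 := by
  classical
  by_contra! hcon
  set N₀ := p / 10 ^ 6 + 1 with hN₀
  have hp' : (10 : ℝ) ^ 6 ≤ p := by exact_mod_cast hp
  have hN2 : 2 ≤ N₀ := by
    have : 1 ≤ p / 10 ^ 6 := (Nat.one_le_div_iff (by norm_num)).2 hp
    omega
  set Q := Nat.primesLE (p - 1) \ Nat.primesLE N₀ with hQ
  have hmemQ : ∀ q ∈ Q, q.Prime ∧ N₀ < q ∧ q < p := by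
    intro q hq
    rw [hQ, Finset.mem_sdiff, Nat.mem_primesLE, Nat.mem_primesLE] at hq
    obtain ⟨⟨h1, h2⟩, h3⟩ := hq
    have : ¬ q ≤ N₀ := fun h => h3 ⟨h, h2⟩
    exact ⟨h2, by omega, by omega⟩
  have hlow : 0.5 * (p : ℝ) ≤ ∑ q ∈ Q, Real.log q := by
    have h1 := theta_sub_one_ge hp
    have h2 := Chebyshev.theta_le_log4_mul_x (x := (N₀ : ℝ)) (by positivity)
    rw [Chebyshev.theta_eq_sum_primesLE_log] at h1 h2
    have h3 : ∑ q ∈ Nat.primesLE (p - 1), Real.log q ≤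
        ∑ q ∈ Q, Real.log q + ∑ q ∈ Nat.primesLE N₀, Real.log q := by
      rw [← Finset.sum_union Finset.sdiff_disjoint]
      refine Finset.sum_le_sum_of_subset_of_nonneg ?_ fun q _ _ => Real.log_natCast_nonneg q
      rw [Finset.sdiff_union_self_eq_union]
      exact Finset.subset_union_left
    have h4 : Real.log 4 ≤ 1.4 := by
      rw [show (4 : ℝ) = 2 ^ 2 by norm_num, Real.log_pow]
      have := Real.log_two_lt_d9
      push_cast; linarith
    have h5 : (N₀ : ℝ) ≤ p / 10 ^ 6 + 1 := by
      rw [hN₀]; push_cast; gcongr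
      exact_mod_cast (Nat.cast_div_le (α := ℝ) (m := p) (n := 10 ^ 6))
    have h6 : Real.log 4 * N₀ ≤ 1.4 * (p / 10 ^ 6 + 1) := by gcongr
    linarith
  set R := (Finset.range (Nat.sqrt (2 * p) + 1)).filter Nat.Prime with hR
  have hcover : ∀ q ∈ Q, ∃ r ∈ R, badModulus r ∣ p + q - 2 := by
    intro q hq
    obtain ⟨hqp, hqN, hqlt⟩ := hmemQ q hq
    obtain ⟨r, k, hr, hk, hdvd, hbig⟩ := hcon q hqp (by omega) hqlt
    refine ⟨r, ?_, (badModulus_dvd hr hk hbig).trans hdvd⟩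
    rw [hR, Finset.mem_filter, Finset.mem_range]
    refine ⟨Nat.lt_succ_of_le (Nat.le_sqrt'.2 ?_), hr⟩
    have hle : r ^ 2 ≤ p + q - 2 :=
      (Nat.pow_le_pow_right hr.pos hk).trans (Nat.le_of_dvd (by omega) hdvd)
    omega
  have hup : ∑ q ∈ Q, Real.log q ≤ 0.3 * p := by
    calc ∑ q ∈ Q, Real.log q ≤ ∑ q ∈ Q, ∑ r ∈ R,
            if badModulus r ∣ p + q - 2 then Real.log q else 0 := by
          refine Finset.sum_le_sum fun q hq => ?_
          have hlog := Real.log_natCast_nonneg q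
          obtain ⟨r, hr, hd⟩ := hcover q hq
          refine le_of_eq_of_le (if_pos hd).symm (Finset.single_le_sum
            (f := fun r => if badModulus r ∣ p + q - 2 then Real.log q else 0)
            (fun r _ => ?_) hr)
          split_ifs <;> positivity
      _ = ∑ r ∈ R, ∑ q ∈ Q with badModulus r ∣ p + q - 2, Real.log q := by
          rw [Finset.sum_comm]
          exact Finset.sum_congr rfl fun r _ => (Finset.sum_filter _ _).symm
      _ ≤ ∑ r ∈ R, ((p : ℝ) / badModulus r + 1) * Real.log (r * badModulus r) := by
          refine Finset.sum_le_sum fun r hr => ?_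
          have hrp := (Finset.mem_filter.1 hr).2
          refine sum_log_progression_le hrp (by omega) (N₀ := N₀) ?_ _ fun q hq => ?_
          · exact Nat.succ_le_succ (Nat.div_le_div_left (le_badModulus hrp) (by norm_num))
          · obtain ⟨hqQ, hd⟩ := Finset.mem_filter.1 hq
            obtain ⟨h1, h2, h3⟩ := hmemQ q hqQ
            exact ⟨h1, h2, h3, hd⟩
      _ ≤ _ := sum_badModulus_term_le hp
  linarith

/-- The product of the `2 ^ j` consecutive naturals starting at `a`. -/
def blockProd (a : ℕ) : ℕ → ℕ
  | 0 => a
  | j + 1 => blockProd a j * blockProd (a + 2 ^ j) j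

/-- The primes from `5` to `131`. -/
def smallPrimes : List ℕ :=
  [5, 7, 11, 13, 17, 19, 23, 29, 31, 37, 41, 43, 47, 53, 59, 61, 67, 71, 73, 79, 83, 89, 97,
  101, 103, 107, 109, 113, 127, 131]

/-- A row `(2, L)`, where the entry of `L` at `k` is a prime `q` such that `2 ^ (k + 3) + 2 - q` is
prime. -/
def twoPowTable : List (ℕ × List ℕ) :=
  [(2, [5, 5, 5, 5, 17, 7, 5, 5, 11, 5, 23, 5, 53, 17, 11, 7, 29, 5, 11, 5, 17, 5, 41, 7, 41,
  59])]

/-- Rows `(r, L)`, where the entry of `L` at `k` is a prime `q` such that `2 * r ^ (k + 2) + 2 - q`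
is prime. -/
def oddPowTable : List (ℕ × List ℕ) :=
  [(3, [7, 13, 7, 31, 7, 13, 31, 67, 7, 37, 7, 7, 19, 13, 103, 79]), (5, [5, 11, 23, 5, 5, 11,
  5, 5, 53, 19]), (7, [11, 5, 5, 17, 11, 5, 11, 47]), (11, [5, 5, 41, 7, 71, 11]), (13, [23, 5,
  5, 29, 89, 17]), (17, [11, 11, 5, 17, 47]), (19, [5, 11, 71, 17, 47]), (23, [11, 7, 5, 5]),
  (29, [17, 13, 83, 17]), (31, [11, 17, 131, 17]), (37, [11, 29, 17]), (41, [5, 13, 5]), (43,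
  [23, 23, 23]), (47, [11, 5, 5]), (53, [29, 29, 47]), (59, [5, 11, 11]), (61, [11, 41, 5]),
  (67, [11, 41]), (71, [5, 7]), (73, [29, 23]), (79, [5, 83]), (83, [17, 13]), (89, [41, 23]),
  (97, [17, 11]), (101, [5, 5]), (103, [29, 17]), (107, [23, 5]), (109, [11, 29]), (113, [17,
  7]), (127, [23, 41]), (131, [5, 13]), (137, [11, 19]), (139, [5, 23]), (149, [23, 13]), (151,
  [5, 5]), (157, [23, 29]), (163, [11, 5]), (167, [17, 5]), (173, [89, 23]), (179, [17]), (181,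
  [5]), (191, [5]), (193, [11]), (197, [29]), (199, [11]), (211, [23]), (223, [29]), (227,
  [11]), (229, [5]), (233, [23]), (239, [23]), (241, [5]), (251, [41]), (257, [29]), (263,
  [17]), (269, [5]), (271, [41]), (277, [11]), (281, [17]), (283, [11]), (293, [29]), (307,
  [17]), (311, [11]), (313, [11]), (317, [53]), (331, [5]), (337, [29]), (347, [23]), (349,
  [17]), (353, [89]), (359, [47]), (367, [29]), (373, [23]), (379, [5]), (383, [23]), (389,
  [47]), (397, [41]), (401, [11]), (409, [17]), (419, [47]), (421, [5]), (431, [11]), (433,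
  [41]), (439, [11]), (443, [11]), (449, [23]), (457, [29]), (461, [5]), (463, [47]), (467,
  [23]), (479, [5]), (487, [29]), (491, [41]), (499, [5]), (503, [41]), (509, [5]), (521, [11]),
  (523, [23]), (541, [23]), (547, [41]), (557, [59]), (563, [17]), (569, [47]), (571, [5]),
  (577, [17]), (587, [47]), (593, [23]), (599, [11]), (601, [41]), (607, [11]), (613, [11]),
  (617, [17]), (619, [11]), (631, [17]), (641, [5]), (643, [17]), (647, [17]), (653, [11]),
  (659, [5]), (661, [71]), (673, [17]), (677, [11]), (683, [11]), (691, [41]), (701, [101]),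
  (709, [5]), (719, [83]), (727, [23]), (733, [47]), (739, [53]), (743, [59]), (751, [11]),
  (757, [17]), (761, [41]), (769, [47]), (773, [23]), (787, [23]), (797, [29]), (809, [47]),
  (811, [47]), (821, [11]), (823, [11]), (827, [29]), (829, [11]), (839, [17]), (853, [17]),
  (857, [11]), (859, [5]), (863, [11]), (877, [47]), (881, [17]), (883, [23]), (887, [53]),
  (907, [47]), (911, [47]), (919, [11]), (929, [5]), (937, [29]), (941, [53]), (947, [29]),
  (953, [17]), (967, [17]), (971, [11]), (977, [17]), (983, [17]), (991, [5]), (997, [29])]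

/-- A sound but incomplete primality test below `2 ^ 16`. -/
def primeTest (m : ℕ) : Bool :=
  smallPrimes.contains m ||
    (Nat.blt 1 m && Nat.blt m (2 ^ 10) && Nat.beq (Nat.gcd m (blockProd 1 5)) 1) ||
    (Nat.blt 1 m && Nat.blt m (2 ^ 16) && Nat.beq (Nat.gcd m (blockProd 1 8)) 1)

/-- Checks a table entry `q` for `n + 2 = p + q`, up to the primality of `p` when `2 ^ 16 ≤ p`. -/
def entryTest (m n q : ℕ) : Bool :=
  smallPrimes.contains q && Nat.blt q m &&
    !(Nat.beq (2 ^ Nat.log2 (n + 3 - q)) (n + 3 - q)) &&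
    ((Nat.ble (2 ^ 16) (n + 2 - q) && Nat.blt (n + 2 - q) (2 ^ 30)) || primeTest (n + 2 - q))

/-- Checks the row `(r, L)` of a table of offsets for the numbers `c * r ^ (k + s)`. -/
def rowTest (c s : ℕ) (e : ℕ × List ℕ) : Bool :=
  Nat.blt (10 ^ 9) (e.1 ^ (e.2.length + s + 1)) &&
    (List.range e.2.length).all fun k =>
      entryTest (e.1 ^ (k + s)) (c * e.1 ^ (k + s)) (e.2.getD k 0)

/-- The numbers from `2 ^ 16` on whose primality a table relies on, the others replaced by `1`. -/
def largeEntries (c s : ℕ) (T : List (ℕ × List ℕ)) : List ℕ :=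
  T.flatMap fun e => (List.range e.2.length).map fun k =>
    bif Nat.ble (2 ^ 16) (c * e.1 ^ (k + s) + 2 - e.2.getD k 0) then
      c * e.1 ^ (k + s) + 2 - e.2.getD k 0 else 1

/-- Checks that a table is correct. -/
def tableTest (c s : ℕ) (T : List (ℕ × List ℕ)) : Bool :=
  T.all (rowTest c s) && Nat.beq (Nat.gcd (largeEntries c s T).prod (blockProd 1 15)) 1

theorem tableTest_twoPowTable : tableTest 1 3 twoPowTable = true := by
  decide +kernel

theorem tableTest_oddPowTable : tableTest 2 2 oddPowTable = true := by
  decide +kernel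

theorem oddPowTable_covers :
    ((List.range 500).all fun i => oddPowTable.any (fun e => Nat.beq e.1 (2 * i + 3)) ||
      (List.range 15).any fun j => Nat.blt (2 * j + 3) (2 * i + 3) &&
        Nat.beq ((2 * i + 3) % (2 * j + 3)) 0) = true := by
  decide +kernel

lemma dvd_blockProd {k a : ℕ} (j : ℕ) (h1 : a ≤ k) (h2 : k < a + 2 ^ j) : k ∣ blockProd a j := by
  induction j generalizing a with
  | zero => rw [show k = a by simp at h2; omega]; rfl
  | succ j ih =>
    rw [blockProd]
    rw [pow_succ] at h2
    rcases lt_or_ge k (a + 2 ^ j) with h | h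
    · exact (ih h1 h).mul_right _
    · exact (ih h (by omega)).mul_left _

lemma prime_of_coprime_blockProd {m j : ℕ} (h1 : 1 < m) (h2 : m < 2 ^ (2 * j))
    (h : m.gcd (blockProd 1 j) = 1) : m.Prime := by
  by_contra hp
  have hsq := Nat.minFac_sq_le_self (by omega) hp
  have hlt : m.minFac < 2 ^ j := by
    rw [mul_comm, pow_mul] at h2
    exact lt_of_pow_lt_pow_left₀ 2 (Nat.zero_le _) (hsq.trans_lt h2)
  have hd := Nat.dvd_gcd m.minFac_dvd
    (dvd_blockProd (a := 1) j m.minFac_pos (by omega))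
  rw [h, Nat.dvd_one, Nat.minFac_eq_one_iff] at hd
  omega

lemma prime_of_mem_smallPrimes : ∀ q ∈ smallPrimes, q.Prime ∧ 5 ≤ q := by
  unfold smallPrimes
  norm_num

lemma prime_of_primeTest {m : ℕ} (h : primeTest m = true) : m.Prime := by
  simp only [primeTest, Bool.or_eq_true, Bool.and_eq_true, Nat.blt_eq, Nat.beq_eq,
    List.contains_iff_mem] at h
  obtain (h | ⟨⟨h1, h2⟩, h3⟩) | ⟨⟨h1, h2⟩, h3⟩ := h
  · exact (prime_of_mem_smallPrimes m h).1
  · exact prime_of_coprime_blockProd (j := 5) h1 h2 h3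
  · exact prime_of_coprime_blockProd (j := 8) h1 h2 h3

lemma exists_primes_of_tableTest {c s r k : ℕ} {T : List (ℕ × List ℕ)} {L : List ℕ}
    (hT : tableTest c s T = true) (hL : (r, L) ∈ T) (hr : 0 < r) (hs : s ≤ k)
    (hk : r ^ (k + 1) ≤ 10 ^ 9) :
    ∃ p q : ℕ, p.Prime ∧ q.Prime ∧ p + q = c * r ^ k + 2 ∧ 5 ≤ q ∧ q < r ^ k ∧
      ∀ j, p + 1 ≠ 2 ^ j := by
  rw [tableTest, Bool.and_eq_true, Nat.beq_eq] at hT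
  obtain ⟨hrow, hgcd⟩ := hT
  have h := List.all_eq_true.1 hrow _ hL
  rw [rowTest, Bool.and_eq_true, Nat.blt_eq] at h
  obtain ⟨hlen, hall⟩ := h
  dsimp only at hlen
  have hkL : k - s < L.length := by
    by_contra! hle
    have := Nat.pow_le_pow_right hr (by omega : L.length + s + 1 ≤ k + 1)
    omega
  have hent := List.all_eq_true.1 hall (k - s) (List.mem_range.2 hkL)
  have hlarge : ∀ p, p = c * r ^ k + 2 - L.getD (k - s) 0 → 2 ^ 16 ≤ p →
      p ∈ largeEntries c s T := by
    intro p hp h16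
    refine List.mem_flatMap.2 ⟨_, hL, List.mem_map.2 ⟨k - s, List.mem_range.2 hkL, ?_⟩⟩
    dsimp only
    rw [Nat.sub_add_cancel hs, ← hp, Nat.ble_eq_true_of_le h16, cond_true]
  dsimp only at hent
  rw [Nat.sub_add_cancel hs] at hent
  set q := L.getD (k - s) 0
  simp only [entryTest, Bool.and_eq_true, Bool.or_eq_true, Nat.blt_eq, Nat.ble_eq,
    Bool.not_eq_true', List.contains_iff_mem] at hent
  obtain ⟨⟨⟨hq, hqm⟩, hpow⟩, hp⟩ := hent
  obtain ⟨hqp, hq5⟩ := prime_of_mem_smallPrimes q hq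
  have hpp : (c * r ^ k + 2 - q).Prime := by
    rcases hp with ⟨h1, h2⟩ | hp
    · refine prime_of_coprime_blockProd (j := 15) (by omega) h2 ?_
      exact Nat.Coprime.coprime_dvd_left (List.dvd_prod (hlarge _ rfl h1)) hgcd
    · exact prime_of_primeTest hp
  have h2 := hpp.two_le
  refine ⟨_, q, hpp, hqp, by omega, hq5, hqm, fun j hj => Nat.ne_of_beq_eq_false hpow ?_⟩
  rw [show c * r ^ k + 3 - q = c * r ^ k + 2 - q + 1 by omega, hj, Nat.log2_two_pow]

lemma exists_primes_two_pow {k : ℕ} (h3 : 3 ≤ k) (hk : 2 ^ (k + 1) ≤ 10 ^ 9) :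
    ∃ p q : ℕ, p.Prime ∧ q.Prime ∧ p + q = 2 ^ k + 2 ∧ 5 ≤ q ∧ q < 2 ^ k ∧
      ∀ j, p + 1 ≠ 2 ^ j := by
  have h := exists_primes_of_tableTest tableTest_twoPowTable List.mem_cons_self two_pos h3 hk
  rwa [one_mul] at h

lemma exists_mem_oddPowTable {r : ℕ} (hr : r.Prime) (hr2 : r ≠ 2) (hr1000 : r < 1000) :
    ∃ L, (r, L) ∈ oddPowTable := by
  have h2 := hr.two_le
  have hodd := hr.eq_two_or_odd.resolve_left hr2
  have h := List.all_eq_true.1 oddPowTable_covers ((r - 3) / 2) (List.mem_range.2 (by omega))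
  rw [show 2 * ((r - 3) / 2) + 3 = r by omega] at h
  simp only [Bool.or_eq_true, List.any_eq_true, Nat.beq_eq, Bool.and_eq_true, Nat.blt_eq] at h
  rcases h with ⟨⟨r', L⟩, hL, rfl⟩ | ⟨j, -, hlt, hmod⟩
  · exact ⟨L, hL⟩
  · have := (Nat.dvd_prime hr).1 (Nat.dvd_of_mod_eq_zero hmod)
    omega

lemma exists_primes_odd_pow {r k : ℕ} (hr : r.Prime) (hr2 : r ≠ 2) (hr1000 : r < 1000)
    (h2 : 2 ≤ k) (hk : r ^ (k + 1) ≤ 10 ^ 9) :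
    ∃ p q : ℕ, p.Prime ∧ q.Prime ∧ p + q = 2 * r ^ k + 2 ∧ 5 ≤ q ∧ q < r ^ k ∧
      ∀ j, p + 1 ≠ 2 ^ j := by
  obtain ⟨L, hL⟩ := exists_mem_oddPowTable hr hr2 hr1000
  exact exists_primes_of_tableTest tableTest_oddPowTable hL hr.pos h2 hk

/-- A multiplicative function with `f (p + q - 2) = f p + f q - f 2` on primes and `f 2 = 2`. -/
structure IsPrimeAdditive (f : ℕ → ℂ) : Prop where
  map_one : f 1 = 1
  map_mul : ∀ m n : ℕ, Nat.Coprime m n → f (m * n) = f m * f n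
  map_primes : ∀ p q : ℕ, p.Prime → q.Prime → f (p + q - 2) = f p + f q - 2
  map_two : f 2 = 2

namespace IsPrimeAdditive

lemma map_three {f : ℕ → ℂ} (hf : IsPrimeAdditive f) : f 3 = 3 := by
  have e4 : f 4 = f 3 + f 3 - 2 := hf.map_primes 3 3 (by norm_num) (by norm_num)
  have e6 : f 6 = f 5 + f 3 - 2 := hf.map_primes 5 3 (by norm_num) (by norm_num)
  have e8 : f 8 = f 5 + f 5 - 2 := hf.map_primes 5 5 (by norm_num) (by norm_num)
  have e8' : f 8 = f 7 + f 3 - 2 := hf.map_primes 7 3 (by norm_num) (by norm_num)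
  have e12 : f 12 = f 7 + f 7 - 2 := hf.map_primes 7 7 (by norm_num) (by norm_num)
  have e14 : f 14 = f 13 + f 3 - 2 := hf.map_primes 13 3 (by norm_num) (by norm_num)
  have e24 : f 24 = f 13 + f 13 - 2 := hf.map_primes 13 13 (by norm_num) (by norm_num)
  have m6 : f 6 = f 2 * f 3 := hf.map_mul 2 3 (by norm_num)
  have m12 : f 12 = f 4 * f 3 := hf.map_mul 4 3 (by norm_num)
  have m14 : f 14 = f 2 * f 7 := hf.map_mul 2 7 (by norm_num)
  have m24 : f 24 = f 8 * f 3 := hf.map_mul 8 3 (by norm_num)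
  rw [hf.map_two] at m6 m14
  set a := f 3
  have h5 : f 5 = a + 2 := by linear_combination m6 - e6
  have h7 : f 7 = a + 4 := by linear_combination e8 - e8' + 2 * h5
  have h13 : f 13 = a + 10 := by linear_combination m14 - e14 + 2 * h7
  have q1 : a * (2 * a - 2) = 2 * a + 6 := by
    linear_combination e12 + 2 * h7 - m12 - a * e4
  have q2 : a * (2 * a + 2) = 2 * a + 18 := by
    linear_combination e24 + 2 * h13 - m24 - a * e8 - 2 * a * h5
  linear_combination (q2 - q1) / 4

lemma map_even_of_forall_lt {f : ℕ → ℂ} (hf : IsPrimeAdditive f) {M n : ℕ}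
    (h : ∀ m, 0 < m → m < M → f m = m) (hn0 : 0 < n)
    (hn : n < 2 * M) (heven : 2 ∣ n) (hpow : ∀ j, n ≠ 2 ^ j) : f n = n := by
  obtain ⟨k, m, hm, rfl⟩ := Nat.exists_eq_two_pow_mul_odd hn0.ne'
  have hk : k ≠ 0 := by
    rintro rfl
    obtain ⟨c, rfl⟩ := hm
    omega
  have hm1 : m ≠ 1 := fun h1 => hpow k (by rw [h1, mul_one])
  have hm3 : 2 ≤ m := by obtain ⟨c, rfl⟩ := hm; omega
  have hk2 : 2 ≤ 2 ^ k := Nat.le_self_pow hk 2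
  rw [hf.map_mul _ _ ((Nat.coprime_two_left.2 hm).pow_left k),
    h (2 ^ k) (by positivity) (by nlinarith), h m (by omega) (by nlinarith)]
  push_cast; ring

lemma map_prime_of_map_add {f : ℕ → ℂ} (hf : IsPrimeAdditive f) {p q : ℕ} (hp : p.Prime)
    (hq : q.Prime) (hfq : f q = q)
    (h : f (p + q - 2) = (p + q - 2 : ℕ)) : f p = p := by
  rw [hf.map_primes p q hp hq, hfq, Nat.cast_sub (by linarith [hp.two_le, hq.two_le])] at h
  push_cast at h
  linear_combination h

lemma map_add_of_map_prime {f : ℕ → ℂ} (hf : IsPrimeAdditive f) {p q n : ℕ}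
    (hp : p.Prime) (hq : q.Prime) (hpq : p + q = n + 2)
    (hfp : f p = p) (hfq : f q = q) : f n = n := by
  have h := hf.map_primes p q hp hq
  have hc : ((p + q : ℕ) : ℂ) = (n + 2 : ℕ) := by rw [hpq]
  rw [hpq, Nat.add_sub_cancel, hfp, hfq] at h
  push_cast at hc
  linear_combination h + hc

lemma map_of_lt {f : ℕ → ℂ} (hf : IsPrimeAdditive f) {n : ℕ} (hn0 : 0 < n) (hn : n < 10 ^ 6) :
    f n = n := by
  induction n using Nat.strong_induction_on with
  | _ n ih =>
  have IH : ∀ m, 0 < m → m < n → f m = m := fun m h0 h => ih m h h0 (h.trans hn)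
  have h3 := hf.map_three
  rcases eq_or_ne n 1 with rfl | hn1
  · simpa using hf.map_one
  set r := n.minFac with hrdef
  have hr : r.Prime := Nat.minFac_prime hn1
  obtain ⟨v, t, hrt, hnt⟩ := Nat.exists_eq_pow_mul_and_not_dvd hn0.ne' r hr.ne_one
  have hv : v ≠ 0 := by
    rintro rfl
    rw [pow_zero, one_mul] at hnt
    exact hrt (hnt ▸ n.minFac_dvd)
  have hrv : 2 ≤ r ^ v := hr.two_le.trans (Nat.le_self_pow hv r)
  rcases eq_or_ne t 1 with ht1 | ht1
  · rw [ht1, mul_one] at hnt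
    rcases eq_or_ne v 1 with rfl | hv1
    · rw [pow_one] at hnt
      rw [← hnt] at hr
      rcases hr.eq_two_or_odd with h | hodd
      · rw [h]; exact_mod_cast hf.map_two
      rcases eq_or_ne n 3 with h | hn3
      · rw [h]; exact_mod_cast h3
      have h2 := hr.two_le
      have hn4 : 4 < n := by omega
      refine hf.map_prime_of_map_add hr Nat.prime_three (by exact_mod_cast h3) ?_
      rw [show n + 3 - 2 = n + 1 by omega]
      by_cases hpow : ∃ j, n + 1 = 2 ^ j
      · obtain ⟨j, hj⟩ := hpow
        have hj3 : 3 ≤ j := by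
          by_contra! hlt
          have := Nat.pow_le_pow_right (n := 2) (by norm_num) (by omega : j ≤ 2)
          omega
        obtain ⟨p, q, hp, hq, hpq, hq5, hqlt, hpne⟩ :=
          exists_primes_two_pow hj3 (by rw [pow_succ, ← hj]; omega)
        have hqn : q ≠ n := by
          intro hqn
          exact hpne 2 (by omega)
        have hp0 := hp.pos
        exact hf.map_add_of_map_prime hp hq (by omega) (IH p hp0 (by omega))
          (IH q (by omega) (by omega))
      · push Not at hpow
        exact hf.map_even_of_forall_lt IH (by omega) (by omega) (by omega) hpow
    · have hv2 : 2 ≤ v := by omega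
      have hr2v : r ^ 2 ≤ r ^ v := Nat.pow_le_pow_right hr.pos hv2
      have hr1000 : r < 1000 := by nlinarith
      have hbound : r ^ (v + 1) ≤ 10 ^ 9 := by
        rw [pow_succ]
        calc r ^ v * r ≤ 10 ^ 6 * 1000 := Nat.mul_le_mul (by omega) (by omega)
          _ = 10 ^ 9 := by norm_num
      by_cases hr2 : r = 2
      · rw [hr2] at hnt hbound
        rcases eq_or_ne v 2 with rfl | hv2'
        · have h4 : n = 4 := by omega
          rw [h4]
          exact hf.map_add_of_map_prime Nat.prime_three Nat.prime_three (by norm_num)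
            (by exact_mod_cast h3) (by exact_mod_cast h3)
        obtain ⟨p, q, hp, hq, hpq, hq5, hqlt, -⟩ := exists_primes_two_pow (by omega) hbound
        have hp0 := hp.pos
        exact hf.map_add_of_map_prime hp hq (by omega) (IH p hp0 (by omega))
          (IH q (by omega) (by omega))
      · obtain ⟨p, q, hp, hq, hpq, hq5, hqlt, hpow⟩ :=
          exists_primes_odd_pow hr hr2 hr1000 hv2 hbound
        rw [← hnt] at hpq hqlt
        have hodd : n % 2 = 1 := by
          rw [hnt]
          exact Nat.odd_iff.1 ((hr.odd_of_ne_two hr2).pow)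
        have hqodd := (hq.eq_two_or_odd).resolve_left (by omega)
        have hp0 := hp.pos
        have hfp : f p = p := by
          refine hf.map_prime_of_map_add hp Nat.prime_three (by exact_mod_cast h3) ?_
          rw [show p + 3 - 2 = p + 1 by omega]
          exact hf.map_even_of_forall_lt IH (by omega) (by omega) (by omega) hpow
        have h2n := hf.map_add_of_map_prime hp hq hpq hfp (IH q (by omega) hqlt)
        rw [hf.map_mul 2 n (Nat.coprime_two_left.2 (Nat.odd_iff.2 hodd)), hf.map_two] at h2n
        push_cast at h2n
        linear_combination h2n / 2
  · have ht0 : t ≠ 0 := by rintro rfl; omega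
    have hcop : Nat.Coprime (r ^ v) t := (hr.coprime_iff_not_dvd.2 hrt).pow_left v
    have ht2 : 2 ≤ t := by omega
    rw [hnt, hf.map_mul _ _ hcop, IH (r ^ v) (by omega) (by nlinarith),
      IH t (by omega) (by nlinarith)]
    push_cast; ring

lemma map_of_forall_factor {f : ℕ → ℂ} (hf : IsPrimeAdditive f) {n : ℕ} (hn : n ≠ 0)
    (h : ∀ r v : ℕ, r.Prime → v = padicValNat r n → 0 < v → f (r ^ v) = (r ^ v : ℕ)) :
    f n = n := by
  rw [Nat.multiplicative_factorization f hf.map_mul hf.map_one hn]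
  conv_rhs => rw [← Nat.prod_factorization_pow_eq_self hn]
  rw [Finsupp.prod, Finsupp.prod, Nat.cast_prod]
  refine Finset.prod_congr rfl fun r hr => ?_
  have hrp := Nat.prime_of_mem_primeFactors (by simpa using hr)
  exact h r _ hrp (Nat.factorization_def n hrp) (Nat.pos_of_ne_zero (Finsupp.mem_support_iff.1 hr))

lemma map_prime {f : ℕ → ℂ} (hf : IsPrimeAdditive f) {p : ℕ} (hp : p.Prime) : f p = p := by
  induction p using Nat.strong_induction_on with
  | _ p ih =>
  rcases lt_or_ge p (10 ^ 6) with hlt | hge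
  · exact hf.map_of_lt hp.pos hlt
  obtain ⟨q, hq, hq2, hqp, hgood⟩ := exists_prime_add_not_bad hge
  refine hf.map_prime_of_map_add hp hq (ih q hqp hq) ?_
  refine hf.map_of_forall_factor (by omega) fun r v hr hv hv0 => ?_
  have hdvd : r ^ v ∣ p + q - 2 := hv ▸ pow_padicValNat_dvd
  rcases eq_or_ne v 1 with rfl | hv1
  · rw [pow_one] at hdvd ⊢
    refine ih r ?_ hr
    have hpo := (hp.eq_two_or_odd).resolve_left (by omega)
    have hqo := (hq.eq_two_or_odd).resolve_left (by omega)
    obtain ⟨c, hc⟩ := hdvd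
    have hc0 : c ≠ 0 := by rintro rfl; omega
    rcases eq_or_ne c 1 with rfl | hc1
    · have := hr.eq_two_or_odd
      omega
    · have hc2 : 2 ≤ c := by omega
      nlinarith [Nat.mul_le_mul_left r hc2, Nat.sub_le (p + q) 2]
  · exact hf.map_of_lt (pow_pos hr.pos v) (hgood r v hr (by omega) hdvd)

lemma map_prime_pow {f : ℕ → ℂ} (hf : IsPrimeAdditive f) {r k : ℕ}
    (hr : r.Prime) (hr1000 : r < 1000) (hk : r ^ (k + 1) ≤ 10 ^ 9) :
    f (r ^ k) = (r ^ k : ℕ) := by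
  rcases lt_or_ge (r ^ k) (10 ^ 6) with hlt | hge
  · exact hf.map_of_lt (pow_pos hr.pos k) hlt
  by_cases hr2 : r = 2
  · subst hr2
    have hk3 : 3 ≤ k := by
      by_contra! h
      have := Nat.pow_le_pow_right (n := 2) (by norm_num) (by omega : k ≤ 2)
      omega
    obtain ⟨p, q, hp, hq, hpq, -⟩ := exists_primes_two_pow hk3 hk
    exact hf.map_add_of_map_prime hp hq hpq (hf.map_prime hp) (hf.map_prime hq)
  · have hk2 : 2 ≤ k := by
      by_contra! h
      have := Nat.pow_le_pow_right hr.pos (by omega : k ≤ 1)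
      rw [pow_one] at this
      omega
    obtain ⟨p, q, hp, hq, hpq, -⟩ := exists_primes_odd_pow hr hr2 hr1000 hk2 hk
    have h := hf.map_add_of_map_prime hp hq hpq (hf.map_prime hp) (hf.map_prime hq)
    rw [hf.map_mul 2 _ (Nat.coprime_two_left.2 ((hr.odd_of_ne_two hr2).pow)), hf.map_two] at h
    push_cast at h ⊢
    linear_combination h / 2

end IsPrimeAdditive

lemma pow_succ_le_of_le_floor {r v : ℕ} (hr : r.Prime)
    (h : (v : ℤ) ≤ ⌊(9 : ℝ) * Real.log 10 / Real.log r⌋ - 1) : r ^ (v + 1) ≤ 10 ^ 9 := by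
  have hlog : 0 < Real.log r := Real.log_pos (by exact_mod_cast hr.one_lt)
  have h1 : ((v + 1 : ℤ) : ℝ) ≤ 9 * Real.log 10 / Real.log r := Int.le_floor.1 (by omega)
  rw [le_div_iff₀ hlog] at h1
  have h2 : Real.log ((r : ℝ) ^ (v + 1)) ≤ Real.log ((10 : ℝ) ^ 9) := by
    rw [Real.log_pow, Real.log_pow]
    exact_mod_cast h1
  have hr0 : (0 : ℝ) < r := by exact_mod_cast hr.pos
  exact_mod_cast (Real.log_le_log_iff (by positivity) (by positivity)).1 h2

theorem stmt_13 (f : ℕ → ℂ)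
    (hf1 : f 1 = 1)
    (hmul : ∀ m n : ℕ, Nat.Coprime m n → f (m * n) = f m * f n)
    (heq : ∀ p q : ℕ, p.Prime → q.Prime → f (p + q - 2) = f p + f q - f 2)
    (hf2 : f 2 = 2) :
    ∀ n ∈ SpiroH, f n = (n : ℂ) := by
  have hf : IsPrimeAdditive f := ⟨hf1, hmul, hf2 ▸ heq, hf2⟩
  rintro n ⟨hn0, hn⟩
  refine hf.map_of_forall_factor hn0.ne' fun r v hr hv hv0 => ?_
  obtain ⟨hlarge, hsmall⟩ := hn r hr
  rw [← hv] at hlarge hsmall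
  rcases lt_trichotomy r 1000 with h | rfl | h
  · exact hf.map_prime_pow hr h (pow_succ_le_of_le_floor hr (hsmall h))
  · norm_num at hr
  · have hv1 : v = 1 := le_antisymm (hlarge h) hv0
    rw [hv1, pow_one]
    exact hf.map_prime hr
end

section
/- For any function g defined on the set of prime powers p^s with p an odd prime and s ≥ 2, there exists a multiplicative function f : ℕ → ℂ satisfying f(p+q-2) = f(p) + f(q) - f(2) for all primes p and q, with f(2) = 0 and f(p^s) = g(p^s) for every odd prime p and every integer s ≥ 2. -/
/-- The multiplicative function vanishing at all primes and all positive powers of `2`, and agreeing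
with `g` at the higher powers of odd primes. -/
noncomputable def higherPowerExtension (g : ℕ → ℂ) (n : ℕ) : ℂ :=
  n.factorization.prod fun p s ↦ if p = 2 ∨ s = 1 then 0 else g (p ^ s)

lemma higherPowerExtension_one (g : ℕ → ℂ) : higherPowerExtension g 1 = 1 := by
  simp [higherPowerExtension]

lemma higherPowerExtension_mul (g : ℕ → ℂ) {m n : ℕ} (h : m.Coprime n) :
    higherPowerExtension g (m * n) = higherPowerExtension g m * higherPowerExtension g n := by
  rw [higherPowerExtension, Nat.factorization_mul_of_coprime h]
  exact Finsupp.prod_add_index_of_disjoint h.disjoint_primeFactors _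

lemma higherPowerExtension_even (g : ℕ → ℂ) {n : ℕ} (hn : n ≠ 0) (h : Even n) :
    higherPowerExtension g n = 0 :=
  Finset.prod_eq_zero
    (Nat.mem_primeFactors.2 ⟨Nat.prime_two, h.two_dvd, hn⟩ : 2 ∈ n.factorization.support) (by simp)

lemma higherPowerExtension_prime_pow (g : ℕ → ℂ) {p s : ℕ} (hp : p.Prime) (hs : s ≠ 0) :
    higherPowerExtension g (p ^ s) = if p = 2 ∨ s = 1 then 0 else g (p ^ s) := by
  rw [higherPowerExtension, hp.factorization_pow, Finsupp.prod,
    Finsupp.support_single _ hs]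
  simp

lemma higherPowerExtension_prime (g : ℕ → ℂ) {p : ℕ} (hp : p.Prime) :
    higherPowerExtension g p = 0 := by
  simpa using higherPowerExtension_prime_pow g hp one_ne_zero

theorem stmt_16 (g : ℕ → ℂ) :
    ∃ f : ℕ → ℂ,
      f 1 = 1 ∧
      (∀ m n : ℕ, Nat.Coprime m n → f (m * n) = f m * f n) ∧
      (∀ p q : ℕ, p.Prime → q.Prime → f (p + q - 2) = f p + f q - f 2) ∧
      f 2 = 0 ∧
      (∀ p s : ℕ, p.Prime → Odd p → 2 ≤ s → f (p ^ s) = g (p ^ s)) := by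
  refine ⟨higherPowerExtension g, higherPowerExtension_one g,
    fun m n ↦ higherPowerExtension_mul g, fun p q hp hq ↦ ?_,
    higherPowerExtension_prime g Nat.prime_two, fun p s hp hodd hs ↦ ?_⟩
  · rcases hp.eq_two_or_odd' with rfl | hp'
    · simp
    rcases hq.eq_two_or_odd' with rfl | hq'
    · simp
    have hp2 := hp.two_le
    have hq2 := hq.two_le
    rw [higherPowerExtension_prime g hp, higherPowerExtension_prime g hq,
      higherPowerExtension_prime g Nat.prime_two,
      higherPowerExtension_even g (by omega) (by grind)]
    simp
  · rw [higherPowerExtension_prime_pow g hp (by omega), if_neg]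
    rintro (rfl | rfl)
    · exact absurd hodd (by decide)
    · omega
end

section
/- The multiplicative function f : ℕ → ℂ defined by f(1) = 1, f(n) = 1 if n ≥ 2 is odd and squareful, and f(n) = 0 otherwise, satisfies f(p+q-2) = f(p) + f(q) - f(2) for all primes p and q. -/
open scoped Classical

/-- A positive integer is squareful (powerful) if every prime dividing it
does so with exponent at least 2. -/
def Squareful (n : ℕ) : Prop := ∀ p : ℕ, p.Prime → p ∣ n → p ^ 2 ∣ n

/-- The function equal to `1` at `1` and at odd squareful numbers, and `0` otherwise. -/
noncomputable def f₀ : ℕ → ℂ := fun n =>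
  if n = 1 then 1 else if 2 ≤ n ∧ Odd n ∧ Squareful n then 1 else 0

theorem squareful_one : Squareful 1 := fun _ hp h => (hp.one_lt.ne' (Nat.dvd_one.mp h)).elim

theorem Squareful.of_mul_left {m n : ℕ} (hmn : m.Coprime n) (h : Squareful (m * n)) :
    Squareful m := fun p hp hpm =>
  ((hmn.coprime_dvd_left hpm).pow_left 2).dvd_of_dvd_mul_right (h p hp (hpm.mul_right n))

theorem squareful_mul_iff {m n : ℕ} (hmn : m.Coprime n) :
    Squareful (m * n) ↔ Squareful m ∧ Squareful n := by
  refine ⟨fun h => ⟨h.of_mul_left hmn, (mul_comm m n ▸ h).of_mul_left hmn.symm⟩, ?_⟩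
  rintro ⟨hm, hn⟩ p hp hdvd
  rcases hp.dvd_mul.mp hdvd with h | h
  · exact (hm p hp h).mul_right n
  · exact (hn p hp h).mul_left m

theorem Nat.Prime.not_squareful {p : ℕ} (hp : p.Prime) : ¬ Squareful p := fun h => by
  have := Nat.le_of_dvd hp.pos (h p hp dvd_rfl)
  nlinarith [hp.two_le]

theorem f₀_eq_ite (n : ℕ) : f₀ n = if Odd n ∧ Squareful n then 1 else 0 := by
  unfold f₀
  by_cases h1 : n = 1
  · subst h1
    simp [squareful_one]
  · have h2 : Odd n → 2 ≤ n := fun h => by have := h.pos; omega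
    rw [if_neg h1]
    exact if_congr ⟨fun h => h.2, fun h => ⟨h2 h.1, h⟩⟩ rfl rfl

theorem f₀_of_even {n : ℕ} (hn : Even n) : f₀ n = 0 := by
  rw [f₀_eq_ite, if_neg fun h => Nat.not_odd_iff_even.mpr hn h.1]

theorem f₀_of_prime {p : ℕ} (hp : p.Prime) : f₀ p = 0 := by
  rw [f₀_eq_ite, if_neg fun h => hp.not_squareful h.2]

theorem f₀_mul {m n : ℕ} (hmn : m.Coprime n) : f₀ (m * n) = f₀ m * f₀ n := by
  simp only [f₀_eq_ite, Nat.odd_mul, squareful_mul_iff hmn, ite_mul, one_mul, zero_mul, ← ite_and]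
  exact if_congr (by tauto) rfl rfl

theorem f₀_prime_add_prime_sub_two {p q : ℕ} (hp : p.Prime) (hq : q.Prime) :
    f₀ (p + q - 2) = 0 := by
  rcases hp.eq_two_or_odd' with rfl | hp'
  · rw [Nat.add_sub_cancel_left, f₀_of_prime hq]
  rcases hq.eq_two_or_odd' with rfl | hq'
  · rw [Nat.add_sub_cancel, f₀_of_prime hp]
  · exact f₀_of_even ((hp'.add_odd hq').tsub even_two)

theorem stmt_17 :
    f₀ 1 = 1 ∧
    (∀ m n : ℕ, Nat.Coprime m n → f₀ (m * n) = f₀ m * f₀ n) ∧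
    (∀ p q : ℕ, p.Prime → q.Prime → f₀ (p + q - 2) = f₀ p + f₀ q - f₀ 2) := by
  refine ⟨if_pos rfl, fun m n => f₀_mul, fun p q hp hq => ?_⟩
  rw [f₀_prime_add_prime_sub_two hp hq, f₀_of_prime hp, f₀_of_prime hq,
    f₀_of_prime Nat.prime_two, add_zero, sub_zero]
end

section
/- If a completely multiplicative function f : ℕ → ℂ satisfies f(p+q-2) = f(p) + f(q) - f(2) for all primes p and q, and f(2) = 0, then f(n) = 0 for all integers n ≥ 2. -/
theorem stmt_18 (f : ℕ → ℂ)
    (hf1 : f 1 = 1)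
    (hmul : ∀ m n : ℕ, 0 < m → 0 < n → f (m * n) = f m * f n)
    (heq : ∀ p q : ℕ, p.Prime → q.Prime → f (p + q - 2) = f p + f q - f 2)
    (hf2 : f 2 = 0) :
    ∀ n : ℕ, 2 ≤ n → f n = 0 := by
  have hprime : ∀ p : ℕ, p.Prime → f p = 0 := by
    intro p hp
    have h2 := hp.two_le
    have h := heq p p hp hp
    rw [show p + p - 2 = 2 * (p - 1) by omega, hmul 2 (p - 1) two_pos (by omega), hf2,
      zero_mul, sub_zero, ← two_mul] at h
    simpa using h.symm
  intro n hn
  obtain ⟨p, hp, k, rfl⟩ := Nat.exists_prime_and_dvd (show n ≠ 1 by omega)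
  have hk : 0 < k := Nat.pos_of_ne_zero (by rintro rfl; simp at hn)
  rw [hmul p k hp.pos hk, hprime p hp, zero_mul]
end
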